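/- The genus-two free energy is explicitly F₂ = (2λ)⁴·(−(21/160)·ϱ₁³/ϱ₀⁵ + (29/128)·ϱ₁ϱ₂/ϱ₀⁴ − (35/384)·ϱ₃/ϱ₀³), where F₂ := (1/(2·(2λ)⁴))·Â_ǎ(z ↦ G₂(z)) and G₂ is the genus-two one-boundary function of the recursion. -/

import Mathlib

open scoped BigOperators
open MeasureTheory

noncomputable section

namespace NCQFT

/-! ### Measure data: the planar 1‑point function `G0fun`, the moments and the operator `K̂`. -/

/-- The planar one-point function `𝒢₀(z) = s·z − n̄ + ½∫ᵃᵇ r(y)/((z+y)y) dy`. -/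
def G0fun (a b s nbar : ℝ) (r : ℝ → ℝ) (z : ℂ) : ℂ :=
  (s : ℂ) * z - (nbar : ℂ) + (1 / 2) * ∫ y in a..b, (r y : ℂ) / ((z + (y : ℂ)) * (y : ℂ))

/-- Moments `ϱ_l = s·δ_{l,0} − ½∫ᵃᵇ r(y)/y^{3+2l} dy` of the measure. -/
def moment (a b s : ℝ) (r : ℝ → ℝ) (l : ℕ) : ℝ :=
  (if l = 0 then s else 0) - (1 / 2) * ∫ y in a..b, r y / y ^ (3 + 2 * l)

/-- The integral operator `K̂`. -/
def Khat (a b s nbar : ℝ) (r : ℝ → ℝ) (f : ℂ → ℂ) (z : ℂ) : ℂ :=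
  G0fun a b s nbar r z * f z + (nbar : ℂ) * f z
    + (1 / 2) * ∫ y in a..b, (r y : ℂ) * (f z - f (y : ℂ)) / (z ^ 2 - (y : ℂ) ^ 2)

/-- Admissible points: `z ∉ [a,b] ∪ (−[a,b]) ∪ {0}`. -/
def Admissible (a b : ℝ) (z : ℂ) : Prop :=
  z ≠ 0 ∧ ∀ y : ℝ, y ∈ Set.Icc a b → z ≠ (y : ℂ) ∧ z ≠ -(y : ℂ)

/-! ### Partial Bell polynomials and the polynomials `S_m(ϱ)`. -/

/-- Partial Bell polynomial `B_{n,k}(x₁,…,x_{n−k+1})`. -/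
def bellP (n k : ℕ) (x : ℕ → ℝ) : ℝ :=
  ∑ j : Fin n → Fin (n + 1),
    if (∑ i : Fin n, (j i : ℕ)) = k ∧ (∑ i : Fin n, ((i : ℕ) + 1) * (j i : ℕ)) = n then
      (n.factorial : ℝ) / (∏ i : Fin n, ((j i : ℕ).factorial : ℝ)) *
        ∏ i : Fin n, (x ((i : ℕ) + 1) / (((i : ℕ) + 1).factorial : ℝ)) ^ (j i : ℕ)
    else 0

/-- `S_m(ϱ) = Σ_{i=0}^m (−1)^i i! ϱ₀^{−i} B_{m,i}(1!ϱ₁,…,(m−i+1)!ϱ_{m−i+1})`. -/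
def Sm (ρ : ℕ → ℝ) (m : ℕ) : ℝ :=
  ∑ i ∈ Finset.range (m + 1),
    (-1) ^ i * (i.factorial : ℝ) * ((ρ 0)⁻¹) ^ i *
      bellP m i (fun j => (j.factorial : ℝ) * ρ j)

/-! ### Partial derivatives in the moment variables. -/

/-- Partial derivative `∂/∂ϱ_l` of a real-valued function of the moments. -/
def pdR (c : (ℕ → ℝ) → ℝ) (l : ℕ) (ρ : ℕ → ℝ) : ℝ :=
  deriv (fun t => c (Function.update ρ l t)) (ρ l)

/-- Partial derivative `∂/∂ϱ_l` of a complex-valued function of the moments. -/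
def pdC (c : (ℕ → ℝ) → ℂ) (l : ℕ) (ρ : ℕ → ℝ) : ℂ :=
  deriv (fun t : ℝ => c (Function.update ρ l t)) (ρ l)

/-! ### Boundary creation operators. -/

/-- Boundary creation operator `Â†_{z_J,w}` with free creation variable `w`, acting on a
family `F` of the moments `ϱ` and boundary variables `(z_i)_{i∈J}`. -/
def AdagFree (J : Finset ℕ) (F : (ℕ → ℝ) → (ℕ → ℂ) → ℂ)
    (ρ : ℕ → ℝ) (z : ℕ → ℂ) (w : ℂ) : ℂ :=
  (∑' l : ℕ, (-((3 + 2 * (l : ℂ)) * (ρ (l + 1) : ℂ)) / ((ρ 0 : ℂ) * w ^ 3)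
      + (3 + 2 * (l : ℂ)) / w ^ (5 + 2 * l)) * pdC (fun σ => F σ z) l ρ)
  + ∑ i ∈ J, (1 / ((ρ 0 : ℂ) * w ^ 3 * z i)) *
      deriv (fun v => F ρ (Function.update z i v)) (z i)

/-- Boundary creation operator creating a boundary at coordinate `p`. -/
def AdagVar (J : Finset ℕ) (p : ℕ) (F : (ℕ → ℝ) → (ℕ → ℂ) → ℂ) :
    (ℕ → ℝ) → (ℕ → ℂ) → ℂ :=
  fun ρ z => AdagFree J F ρ z (z p)

/-- Boundary creation operator `Â†_w` acting on scalar functions of the moments only. -/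
def AdagScalar (F : (ℕ → ℝ) → ℝ) (ρ : ℕ → ℝ) (w : ℂ) : ℂ :=
  ∑' l : ℕ, (-((3 + 2 * (l : ℂ)) * (ρ (l + 1) : ℂ)) / ((ρ 0 : ℂ) * w ^ 3)
      + (3 + 2 * (l : ℂ)) / w ^ (5 + 2 * l)) * (pdR F l ρ : ℂ)

/-! ### The genus recursion for the 1-boundary functions `𝒢_g(z) = Σ_k c_{g,k}(ϱ)/z^{2k+3}`. -/

/-- Coefficients `e_m(ϱ)` of the even bracket
`w²·(Σ_{h=1}^{g-1} G_h(w)G_{g−h}(w) + (2λ)²·G_{g−1}(w|w))`, expressed through the table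
`prev` of the coefficients of the lower-genus one-boundary functions. -/
def eBr (lam : ℝ) (g : ℕ) (prev : ℕ → ℕ → (ℕ → ℝ) → ℝ) (m : ℕ) (ρ : ℕ → ℝ) : ℝ :=
  (∑ h ∈ Finset.Icc 1 (g - 1), ∑ i ∈ Finset.range (m + 1), ∑ j ∈ Finset.range (m + 1),
      if i + j + 2 = m then prev h i ρ * prev (g - h) j ρ else 0)
  + (2 * lam) ^ 4 *
    ((if 2 ≤ m then
        -(1 / ρ 0) * ∑' l : ℕ, (3 + 2 * (l : ℝ)) * ρ (l + 1) * pdR (prev (g - 1) (m - 2)) l ρ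
      else 0)
    + (∑ k ∈ Finset.range (m + 1), ∑ l ∈ Finset.range (m + 1),
        if k + l + 3 = m then (3 + 2 * (l : ℝ)) * pdR (prev (g - 1) k) l ρ else 0)
    + (if 3 ≤ m then -(((2 * (m - 3) + 3 : ℕ) : ℝ) * prev (g - 1) (m - 3) ρ) / ρ 0 else 0))

/-- Table of the coefficients of the one-boundary functions for all genera `h ≤ G`.
`Gtab lam G h k ρ` is the coefficient of `z^{-(2k+3)}` in `𝒢_h(z)`. -/
def Gtab (lam : ℝ) : ℕ → ℕ → ℕ → (ℕ → ℝ) → ℝ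
  | 0 => fun _ _ _ => 0
  | 1 => fun h k ρ =>
      if h = 1 then
        (if k = 0 then 2 * lam ^ 4 * ρ 1 / (ρ 0) ^ 2
         else if k = 1 then -(2 * lam ^ 4) / ρ 0 else 0)
      else 0
  | (G + 2) => fun h k ρ =>
      if h ≤ G + 1 then Gtab lam (G + 1) h k ρ
      else if h = G + 2 then
        -(1 / (2 * ρ 0)) *
          ∑' j : ℕ, eBr lam (G + 2) (Gtab lam (G + 1)) (k + j) ρ * Sm ρ j / (j.factorial : ℝ)
      else 0

/-- Coefficients of the genus-`g` one-boundary function. -/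
def Gcoef (lam : ℝ) (g : ℕ) : ℕ → (ℕ → ℝ) → ℝ := Gtab lam g g

/-- One-boundary function `𝒢_g(z)` of genus `g ≥ 1`. -/
def Gfun (lam : ℝ) (g : ℕ) (ρ : ℕ → ℝ) (z : ℂ) : ℂ :=
  ∑' k : ℕ, (Gcoef lam g k ρ : ℂ) / z ^ (2 * k + 3)

/-- The same-point two-boundary function `𝒢_g(z|z)`, with
`𝒢₀(z|z) := λ²/z⁴` and `𝒢_g(z|z) := (2λ)²(Â†_z + (1/(ϱ₀z⁴))∂_z)𝒢_g(z)` for `g ≥ 1`. -/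
def Gpair (lam : ℝ) (g : ℕ) (ρ : ℕ → ℝ) (z : ℂ) : ℂ :=
  if g = 0 then (lam : ℂ) ^ 2 / z ^ 4
  else (2 * (lam : ℂ)) ^ 2 *
    ((∑' l : ℕ, (-((3 + 2 * (l : ℂ)) * (ρ (l + 1) : ℂ)) / ((ρ 0 : ℂ) * z ^ 3)
        + (3 + 2 * (l : ℂ)) / z ^ (5 + 2 * l)) * pdC (fun σ => Gfun lam g σ z) l ρ)
     + (1 / ((ρ 0 : ℂ) * z ^ 4)) * deriv (Gfun lam g ρ) z)

/-! ### Multi-boundary functions. -/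

/-- Iterated boundary creation for `g ≥ 1` (without prefactors); coordinates `0,…,B−1`. -/
def GBraw (lam : ℝ) (g : ℕ) : ℕ → (ℕ → ℝ) → (ℕ → ℂ) → ℂ
  | 0 => fun _ _ => 0
  | 1 => fun ρ z => Gfun lam g ρ (z 0)
  | (B + 2) => AdagVar (Finset.range (B + 1)) (B + 1) (GBraw lam g (B + 1))

/-- Iterated boundary creation for `g = 0` (without prefactors), starting from `𝒢₀(z₁|z₂)`. -/
def GBraw0 (lam : ℝ) : ℕ → (ℕ → ℝ) → (ℕ → ℂ) → ℂ
  | 0 => fun _ _ => 0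
  | 1 => fun _ _ => 0
  | 2 => fun _ z => 4 * (lam : ℂ) ^ 2 / (z 0 * z 1 * (z 0 + z 1) ^ 2)
  | (B + 3) => AdagVar (Finset.range (B + 2)) (B + 2) (GBraw0 lam (B + 2))

/-- The multi-boundary functions `𝒢_g(z₁|…|z_B)`, with variables at coordinates `0,…,B−1`:
`𝒢_g(z₁|…|z_B) = (2λ)^{3B−4} Â†_{(z₁..z_{B−1}),z_B}(⋯ Â†_{(z₁),z₂}𝒢_g(z₁)⋯)` for `g ≥ 1`,
and `𝒢₀(z₁|…|z_B) = (2λ)^{3B−6} Â†(⋯ Â†𝒢₀(z₁|z₂)⋯)` for `g = 0`. -/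
def GBfun (lam : ℝ) (g B : ℕ) (ρ : ℕ → ℝ) (z : ℕ → ℂ) : ℂ :=
  if g = 0 then (2 * (lam : ℂ)) ^ (3 * B - 6) * GBraw0 lam B ρ z
  else if B = 1 then Gfun lam g ρ (z 0)
  else (2 * (lam : ℂ)) ^ (3 * B - 4) * GBraw lam g B ρ z

/-! ### Free energies and boundary annihilation. -/

/-- Boundary annihilation applied to `𝒢_g`:  `Â_ǎ 𝒢_g = −Σ_l ϱ_l/(3+2l) · c_{g,l+1}(ϱ)`
(the coefficient of `z^{−5−2l}` in `𝒢_g(z)` is `c_{g,l+1}`). -/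
def AcheckG (lam : ℝ) (g : ℕ) (ρ : ℕ → ℝ) : ℝ :=
  -∑' l : ℕ, ρ l / (3 + 2 * (l : ℝ)) * Gcoef lam g (l + 1) ρ

/-- Free energies: `F₁ = −(1/24)·log ϱ₀`, and
`F_g = (1/((2g−2)(2λ)⁴))·Â_ǎ(𝒢_g)` for `g ≥ 2`. -/
def Ffree (lam : ℝ) (g : ℕ) (ρ : ℕ → ℝ) : ℝ :=
  if g = 1 then -(1 / 24) * Real.log (ρ 0)
  else 1 / ((2 * (g : ℝ) - 2) * (2 * lam) ^ 4) * AcheckG lam g ρ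

/-! ### Auxiliary notions. -/

/-- Variable assignment `(z₁, z_{i₁}, z_{i₂}, …)` with first slot `w` and the remaining slots
filled by the coordinates of `z` indexed by the set `I` in increasing order. -/
def slotAt (z : ℕ → ℂ) (w : ℂ) (I : Finset ℕ) : ℕ → ℂ :=
  fun n => if n = 0 then w else z ((I.sort (· ≤ ·)).getD (n - 1) 0)

/-- A polynomial in variables `x₁,…,x_j` is `j`-weighted if each of its monomials
`∏ x_i^{m_i}` satisfies `Σ i·m_i = j`. -/
def IsWeighted (j : ℕ) (P : MvPolynomial (Fin j) ℚ) : Prop :=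
  ∀ m ∈ P.support, (∑ i : Fin j, ((i : ℕ) + 1) * m i) = j

/-- A smooth family `F(ϱ₀,…,ϱ_M; (z_i)_{i∈J})`: it factors through a function of the first
`M+1` moments and the coordinates in `J` which is smooth (and holomorphic in each `z_i`)
on the region `ϱ₀ ≠ 0`, `z_i ≠ 0`. -/
def SmoothFam (M : ℕ) (J : Finset ℕ) (F : (ℕ → ℝ) → (ℕ → ℂ) → ℂ) : Prop :=
  ∃ Ft : ((Fin (M + 1) → ℝ) × ({ i // i ∈ J } → ℂ)) → ℂ,
    ContDiffOn ℝ (⊤ : ℕ∞) Ft { x | x.1 0 ≠ 0 ∧ ∀ i, x.2 i ≠ 0 } ∧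
    (∀ x ∈ ({ x : (Fin (M + 1) → ℝ) × ({ i // i ∈ J } → ℂ) |
        x.1 0 ≠ 0 ∧ ∀ i, x.2 i ≠ 0 }), ∀ i,
      DifferentiableAt ℂ (fun w => Ft (x.1, Function.update x.2 i w)) (x.2 i)) ∧
    ∀ ρ z, F ρ z = Ft (fun l => ρ (l : ℕ), fun i => z (i : ℕ))

/-- A smooth scalar function of `ϱ₀ ≠ 0, ϱ₁, …, ϱ_M`. -/
def SmoothScalarFam (M : ℕ) (F : (ℕ → ℝ) → ℝ) : Prop :=
  ∃ Ft : (Fin (M + 1) → ℝ) → ℝ,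
    ContDiffOn ℝ (⊤ : ℕ∞) Ft { v | v 0 ≠ 0 } ∧ ∀ ρ : ℕ → ℝ, F ρ = Ft (fun l => ρ (l : ℕ))

/-! ### The Laplacian of Theorem `Δ_ϱ`. -/

/-- `R_m(ϱ) = −(2/3) Σ_{k=1}^m (kϱ_k/((3+2k)ϱ₀))·S_{m−k}(ϱ)/(m−k)!`. -/
def Rm (ρ : ℕ → ℝ) (m : ℕ) : ℝ :=
  -(2 / 3) * ∑ k ∈ Finset.Icc 1 m,
    ((k : ℝ) * ρ k / ((3 + 2 * (k : ℝ)) * ρ 0)) * (Sm ρ (m - k) / ((m - k).factorial : ℝ))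

/-- The Laplacian `Δ_ϱ`, acting on functions of the moments. -/
def DeltaRho (F : (ℕ → ℝ) → ℝ) (ρ : ℕ → ℝ) : ℝ :=
  -(-(6 * ρ 1 ^ 3) / (5 * ρ 0 ^ 3) + 111 * ρ 1 * ρ 2 / (70 * ρ 0 ^ 2)
      - ρ 3 / (2 * ρ 0)) * pdR (fun σ => pdR F 0 σ) 0 ρ
  - (2 * ρ 1 ^ 3 / ρ 0 ^ 4 - 1097 * ρ 1 * ρ 2 / (280 * ρ 0 ^ 3)
      + 41 * ρ 3 / (24 * ρ 0 ^ 2)) * pdR F 0 ρ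
  - (∑' k : ℕ, (3 + 2 * ((k : ℝ) + 1)) *
      ((-(2 * ρ 1 ^ 2 / (5 * ρ 0 ^ 3)) + 2 * ρ 2 / (7 * ρ 0 ^ 2)) * ρ (k + 2)
        - 3 * Rm ρ (k + 3) * ρ 1 / (2 * ρ 0) + 3 * Rm ρ (k + 4) / 2) *
      pdR (fun σ => pdR F 0 σ) (k + 1) ρ)
  - (∑' k : ℕ, ∑' l : ℕ, (3 + 2 * ((k : ℝ) + 1)) * (3 + 2 * ((l : ℝ) + 1)) *
      (-(ρ 1 * ρ (l + 2) * ρ (k + 2) / (30 * ρ 0 ^ 2))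
        - ρ (k + 2) * Rm ρ (l + 3) / (4 * ρ 0)
        - ρ (l + 2) * Rm ρ (k + 3) / (4 * ρ 0)
        + Rm ρ (k + l + 5) / 4) *
      pdR (fun σ => pdR F (l + 1) σ) (k + 1) ρ)
  - (∑' k : ℕ, (3 + 2 * ((k : ℝ) + 1)) *
      ((19 * ρ 1 ^ 2 / (60 * ρ 0 ^ 4) - 25 * ρ 2 / (84 * ρ 0 ^ 3)) * ρ (k + 2)
        + ρ 1 * Rm ρ (k + 3) / (16 * ρ 0 ^ 2)
        - Rm ρ (k + 4) / (16 * ρ 0)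
        - (5 + 2 * ((k : ℝ) + 1)) * ρ 1 * ρ (k + 3) / (30 * ρ 0 ^ 3)
        - (5 + 2 * ((k : ℝ) + 1)) * Rm ρ (k + 4) / (2 * ρ 0)) *
      pdR F (k + 1) ρ)

/-- The operator `D = −(2λ)⁴Δ_ϱ + (2λ)⁴·(−21ϱ₁³/(160ϱ₀⁵)+29ϱ₁ϱ₂/(128ϱ₀⁴)−35ϱ₃/(384ϱ₀³))·`. -/
def Dop (lam : ℝ) (F : (ℕ → ℝ) → ℝ) : (ℕ → ℝ) → ℝ :=
  fun ρ => -(2 * lam) ^ 4 * DeltaRho F ρ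
    + (2 * lam) ^ 4 * (-(21 / 160) * ρ 1 ^ 3 / ρ 0 ^ 5 + (29 / 128) * ρ 1 * ρ 2 / ρ 0 ^ 4
        - (35 / 384) * ρ 3 / ρ 0 ^ 3) * F ρ

end NCQFT

namespace NCQFT

lemma bellP_filter (n k : ℕ) (x : ℕ → ℝ) (s : Finset (Fin n → Fin (n + 1)))
    (hs : (Finset.univ.filter fun j : Fin n → Fin (n + 1) =>
      (∑ i : Fin n, (j i : ℕ)) = k ∧ (∑ i : Fin n, ((i : ℕ) + 1) * (j i : ℕ)) = n) = s) :
    bellP n k x = ∑ j ∈ s, (n.factorial : ℝ) / (∏ i : Fin n, ((j i : ℕ).factorial : ℝ)) *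
        ∏ i : Fin n, (x ((i : ℕ) + 1) / (((i : ℕ) + 1).factorial : ℝ)) ^ (j i : ℕ) := by
  rw [← hs, Finset.sum_filter]
  rfl

lemma Sm_zero (ρ : ℕ → ℝ) : Sm ρ 0 = 1 := by
  simp [Sm, bellP]

lemma Sm_one (ρ : ℕ → ℝ) : Sm ρ 1 = -(ρ 1 / ρ 0) := by
  simp only [Sm, Finset.sum_range_succ, Finset.sum_range_zero]
  rw [bellP_filter 1 0 _ ∅ (by decide), bellP_filter 1 1 _ {![1]} (by decide)]
  simp
  ring

lemma Sm_two (ρ : ℕ → ℝ) : Sm ρ 2 = 2 * (ρ 1 ^ 2 / ρ 0 ^ 2 - ρ 2 / ρ 0) := by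
  simp only [Sm, Finset.sum_range_succ, Finset.sum_range_zero]
  rw [bellP_filter 2 0 _ ∅ (by decide), bellP_filter 2 1 _ {![0, 1]} (by decide),
    bellP_filter 2 2 _ {![2, 0]} (by decide)]
  simp [Fin.prod_univ_succ, Nat.factorial]
  ring

lemma Sm_three (ρ : ℕ → ℝ) :
    Sm ρ 3 = 6 * (-(ρ 1 ^ 3 / ρ 0 ^ 3) + 2 * ρ 1 * ρ 2 / ρ 0 ^ 2 - ρ 3 / ρ 0) := by
  simp only [Sm, Finset.sum_range_succ, Finset.sum_range_zero]
  rw [bellP_filter 3 0 _ ∅ (by decide), bellP_filter 3 1 _ {![0, 0, 1]} (by decide),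
    bellP_filter 3 2 _ {![1, 1, 0]} (by decide), bellP_filter 3 3 _ {![3, 0, 0]} (by decide)]
  simp [Fin.prod_univ_succ, Nat.factorial]
  ring

lemma Gtab1_zero (lam : ℝ) :
    Gtab lam 1 1 0 = fun ρ => 2 * lam ^ 4 * ρ 1 / (ρ 0) ^ 2 := by
  funext ρ; simp [Gtab]

lemma Gtab1_one (lam : ℝ) :
    Gtab lam 1 1 1 = fun ρ => -(2 * lam ^ 4) / ρ 0 := by
  funext ρ; simp [Gtab]

lemma Gtab1_ge (lam : ℝ) (k : ℕ) (hk : 2 ≤ k) : Gtab lam 1 1 k = fun _ => 0 := by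
  funext ρ
  have h0 : k ≠ 0 := by omega
  have h1 : k ≠ 1 := by omega
  simp [Gtab, h0, h1]

lemma pd00 (lam : ℝ) (ρ : ℕ → ℝ) (h : ρ 0 ≠ 0) :
    pdR (Gtab lam 1 1 0) 0 ρ = -(4 * lam ^ 4 * ρ 1) / ρ 0 ^ 3 := by
  rw [Gtab1_zero, pdR]
  have : HasDerivAt (fun t : ℝ => 2 * lam ^ 4 * ρ 1 / t ^ 2)
      (-(4 * lam ^ 4 * ρ 1) / ρ 0 ^ 3) (ρ 0) := by
    have := ((hasDerivAt_const (ρ 0) (2 * lam ^ 4 * ρ 1)).div (hasDerivAt_pow 2 (ρ 0))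
      (pow_ne_zero 2 h))
    refine this.congr_deriv ?_
    field_simp
    norm_num
    ring
  simpa using this.deriv

lemma pd01 (lam : ℝ) (ρ : ℕ → ℝ) :
    pdR (Gtab lam 1 1 0) 1 ρ = 2 * lam ^ 4 / ρ 0 ^ 2 := by
  rw [Gtab1_zero, pdR]
  have : HasDerivAt (fun t : ℝ => 2 * lam ^ 4 * t / ρ 0 ^ 2)
      (2 * lam ^ 4 / ρ 0 ^ 2) (ρ 1) := by
    simpa using (((hasDerivAt_id (ρ 1)).const_mul (2 * lam ^ 4)).div_const (ρ 0 ^ 2))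
  simpa using this.deriv

lemma pd0_ge (lam : ℝ) (ρ : ℕ → ℝ) (l : ℕ) (hl : 2 ≤ l) :
    pdR (Gtab lam 1 1 0) l ρ = 0 := by
  rw [Gtab1_zero, pdR]
  have h0 : (0 : ℕ) ≠ l := by omega
  have h1 : (1 : ℕ) ≠ l := by omega
  simp [Function.update_of_ne h0, Function.update_of_ne h1]

lemma pd10 (lam : ℝ) (ρ : ℕ → ℝ) (h : ρ 0 ≠ 0) :
    pdR (Gtab lam 1 1 1) 0 ρ = 2 * lam ^ 4 / ρ 0 ^ 2 := by
  rw [Gtab1_one, pdR]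
  have : HasDerivAt (fun t : ℝ => -(2 * lam ^ 4) / t)
      (2 * lam ^ 4 / ρ 0 ^ 2) (ρ 0) := by
    have := ((hasDerivAt_const (ρ 0) (-(2 * lam ^ 4))).div (hasDerivAt_id (ρ 0)) h)
    refine this.congr_deriv ?_
    simp
  simpa using this.deriv

lemma pd1_ge (lam : ℝ) (ρ : ℕ → ℝ) (l : ℕ) (hl : 1 ≤ l) :
    pdR (Gtab lam 1 1 1) l ρ = 0 := by
  rw [Gtab1_one, pdR]
  have h0 : (0 : ℕ) ≠ l := by omega
  simp [Function.update_of_ne h0]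

lemma pd_ge (lam : ℝ) (ρ : ℕ → ℝ) (k l : ℕ) (hk : 2 ≤ k) :
    pdR (Gtab lam 1 1 k) l ρ = 0 := by
  rw [Gtab1_ge lam k hk, pdR]
  simp

lemma ts0 (lam : ℝ) (ρ : ℕ → ℝ) (h : ρ 0 ≠ 0) :
    ∑' l : ℕ, (3 + 2 * (l : ℝ)) * ρ (l + 1) * pdR (Gtab lam 1 1 0) l ρ
      = 3 * ρ 1 * (-(4 * lam ^ 4 * ρ 1) / ρ 0 ^ 3) + 5 * ρ 2 * (2 * lam ^ 4 / ρ 0 ^ 2) := by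
  rw [tsum_eq_sum (s := Finset.range 2)]
  · simp [Finset.sum_range_succ, pd00 lam ρ h, pd01]
    norm_num
  · intro l hl
    rw [pd0_ge lam ρ l (by simp at hl; omega), mul_zero]

lemma ts1 (lam : ℝ) (ρ : ℕ → ℝ) (h : ρ 0 ≠ 0) :
    ∑' l : ℕ, (3 + 2 * (l : ℝ)) * ρ (l + 1) * pdR (Gtab lam 1 1 1) l ρ
      = 3 * ρ 1 * (2 * lam ^ 4 / ρ 0 ^ 2) := by
  rw [tsum_eq_sum (s := Finset.range 1)]
  · simp [pd10 lam ρ h]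
  · intro l hl
    rw [pd1_ge lam ρ l (by simpa [Nat.one_le_iff_ne_zero] using hl), mul_zero]

lemma e1 (lam : ℝ) (ρ : ℕ → ℝ) : eBr lam 2 (Gtab lam 1) 1 ρ = 0 := by
  simp [eBr, Finset.sum_range_succ]

lemma e2 (lam : ℝ) (ρ : ℕ → ℝ) (h : ρ 0 ≠ 0) : eBr lam 2 (Gtab lam 1) 2 ρ
    = lam ^ 8 * (196 * ρ 1 ^ 2 / ρ 0 ^ 4 - 160 * ρ 2 / ρ 0 ^ 3) := by
  simp [eBr, Finset.sum_range_succ, ts0 lam ρ h, congr_fun (Gtab1_zero lam) ρ]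
  field_simp
  ring

lemma e3 (lam : ℝ) (ρ : ℕ → ℝ) (h : ρ 0 ≠ 0) : eBr lam 2 (Gtab lam 1) 3 ρ
    = lam ^ 8 * (-392 * ρ 1 / ρ 0 ^ 3) := by
  simp [eBr, Finset.sum_range_succ, ts1 lam ρ h, pd00 lam ρ h, congr_fun (Gtab1_zero lam) ρ,
    congr_fun (Gtab1_one lam) ρ]
  field_simp
  ring

lemma e4 (lam : ℝ) (ρ : ℕ → ℝ) (h : ρ 0 ≠ 0) : eBr lam 2 (Gtab lam 1) 4 ρ
    = lam ^ 8 * (420 / ρ 0 ^ 2) := by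
  simp [eBr, Finset.sum_range_succ, pd10 lam ρ h, pd01, pd_ge, congr_fun (Gtab1_zero lam) ρ,
    congr_fun (Gtab1_one lam) ρ, congr_fun (Gtab1_ge lam 2 le_rfl) ρ]
  field_simp
  ring

lemma e_ge (lam : ℝ) (ρ : ℕ → ℝ) (m : ℕ) (hm : 5 ≤ m) :
    eBr lam 2 (Gtab lam 1) m ρ = 0 := by
  have hA : ∀ i j : ℕ, i + j + 2 = m → Gtab lam 1 1 i ρ * Gtab lam 1 1 j ρ = 0 := by
    intro i j hij
    rcases (by omega : 2 ≤ i ∨ 2 ≤ j) with h | h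
    · rw [Gtab1_ge lam i h, zero_mul]
    · rw [Gtab1_ge lam j h, mul_zero]
  have hB : ∀ k l : ℕ, k + l + 3 = m → pdR (Gtab lam 1 1 k) l ρ = 0 := by
    intro k l hkl
    rcases (by omega : k = 0 ∨ k = 1 ∨ 2 ≤ k) with rfl | rfl | h
    · exact pd0_ge lam ρ l (by omega)
    · exact pd1_ge lam ρ l (by omega)
    · exact pd_ge lam ρ k l h
  have h1 : ∑ i ∈ Finset.range (m + 1), ∑ j ∈ Finset.range (m + 1),
      (if i + j + 2 = m then Gtab lam 1 1 i ρ * Gtab lam 1 1 j ρ else 0) = 0 := by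
    refine Finset.sum_eq_zero fun i _ => Finset.sum_eq_zero fun j _ => ?_
    split_ifs with hij
    · exact hA i j hij
    · rfl
  have h2 : ∑ k ∈ Finset.range (m + 1), ∑ l ∈ Finset.range (m + 1),
      (if k + l + 3 = m then (3 + 2 * (l : ℝ)) * pdR (Gtab lam 1 1 k) l ρ else 0) = 0 := by
    refine Finset.sum_eq_zero fun i _ => Finset.sum_eq_zero fun j _ => ?_
    split_ifs with hij
    · rw [hB i j hij, mul_zero]
    · rfl
  have h3 : ∀ l, pdR (Gtab lam 1 1 (m - 2)) l ρ = 0 := fun l => pd_ge lam ρ _ l (by omega)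
  have h4 : Gtab lam 1 1 (m - 3) ρ = 0 := by rw [Gtab1_ge lam _ (by omega)]
  simp only [eBr, Nat.add_one_sub_one, Finset.Icc_self, Finset.sum_singleton, h1, h2,
    show 2 - 1 = 1 from rfl, h3, h4]
  simp

lemma G2_eq (lam : ℝ) (ρ : ℕ → ℝ) (k n : ℕ) (hkn : 5 ≤ k + n) : Gcoef lam 2 k ρ
    = -(1 / (2 * ρ 0)) * ∑ j ∈ Finset.range n,
      eBr lam 2 (Gtab lam 1) (k + j) ρ * Sm ρ j / (j.factorial : ℝ) := by
  have : Gcoef lam 2 k ρ = -(1 / (2 * ρ 0)) * ∑' j : ℕ,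
      eBr lam 2 (Gtab lam 1) (k + j) ρ * Sm ρ j / (j.factorial : ℝ) := by
    simp [Gcoef, Gtab]
  rw [this, tsum_eq_sum (s := Finset.range n)]
  intro j hj
  have hj' : n ≤ j := by simpa using hj
  rw [e_ge lam ρ (k + j) (by omega), zero_mul, zero_div]

end NCQFT

open NCQFT in
/-- The genus-two free energy is
`F₂ = (2λ)⁴(−(21/160)ϱ₁³/ϱ₀⁵ + (29/128)ϱ₁ϱ₂/ϱ₀⁴ − (35/384)ϱ₃/ϱ₀³)`. -/
theorem stmt19 (lam : ℝ) (hlam : lam ≠ 0) (ρ : ℕ → ℝ) (hρ0 : ρ 0 ≠ 0) :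
    Ffree lam 2 ρ
      = (2 * lam) ^ 4 * (-(21 / 160) * ρ 1 ^ 3 / ρ 0 ^ 5
          + (29 / 128) * ρ 1 * ρ 2 / ρ 0 ^ 4 - (35 / 384) * ρ 3 / ρ 0 ^ 3) := by
  have c1 := G2_eq lam ρ 1 4 (by norm_num)
  have c2 := G2_eq lam ρ 2 3 (by norm_num)
  have c3 := G2_eq lam ρ 3 2 (by norm_num)
  have c4 := G2_eq lam ρ 4 1 (by norm_num)
  have cg : ∀ k, 5 ≤ k → Gcoef lam 2 k ρ = 0 := by
    intro k hk
    rw [G2_eq lam ρ k 0 (by omega)]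
    simp
  simp only [Finset.sum_range_succ, Finset.sum_range_zero, Nat.reduceAdd, Sm_zero, Sm_one, Sm_two,
    Sm_three, e1, e2 lam ρ hρ0, e3 lam ρ hρ0, e4 lam ρ hρ0] at c1 c2 c3 c4
  have hA : AcheckG lam 2 ρ = -(ρ 0 / 3 * Gcoef lam 2 1 ρ + ρ 1 / 5 * Gcoef lam 2 2 ρ
      + ρ 2 / 7 * Gcoef lam 2 3 ρ + ρ 3 / 9 * Gcoef lam 2 4 ρ) := by
    rw [AcheckG, tsum_eq_sum (s := Finset.range 4)]
    · simp only [Finset.sum_range_succ, Finset.sum_range_zero]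
      norm_num
    · intro l hl
      have hl' : 4 ≤ l := by simpa using hl
      rw [cg (l + 1) (by omega), mul_zero]
  rw [Ffree, if_neg (by norm_num), hA, c1, c2, c3, c4]
  simp only [Nat.factorial]
  push_cast
  field_simp
  ring
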